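/- arXiv:2007.11059 — 3 statements merged into one kernel-verified Lean document; each statement's English description precedes it below -/
import Mathlib

section
/- Let M₁, …, Mₙ and N be objects of an abelian category 𝒜. Then N is dual (⊕ᵢ₌₁ⁿ Mᵢ)-CS-Rickart if and only if N is dual Mᵢ-CS-Rickart for every i ∈ {1, …, n}. -/
open CategoryTheory CategoryTheory.Limits

universe v u

variable {𝒜 : Type u} [Category.{v} 𝒜] [Abelian 𝒜]

/-- A monomorphism `e` is essential if whenever `e ≫ h` is a mono, `h` is a mono. -/
def IsEssentialMono {K L : 𝒜} (e : K ⟶ L) : Prop :=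
  Mono e ∧ ∀ ⦃P : 𝒜⦄ (h : L ⟶ P), Mono (e ≫ h) → Mono h

/-- An epimorphism `t` is superfluous if whenever `h ≫ t` is an epi, `h` is an epi. -/
def IsSuperfluousEpi {P C : 𝒜} (t : P ⟶ C) : Prop :=
  Epi t ∧ ∀ ⦃Q : 𝒜⦄ (h : Q ⟶ P), Epi (h ≫ t) → Epi h

/-- `N` is `M`-CS-Rickart: for every `f : M ⟶ N` the kernel morphism factors as an
essential monomorphism followed by a section. -/
def IsCSRickart (M N : 𝒜) : Prop :=
  ∀ f : M ⟶ N, ∃ (L : 𝒜) (e : kernel f ⟶ L) (s : L ⟶ M),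
    IsEssentialMono e ∧ IsSplitMono s ∧ kernel.ι f = e ≫ s

/-- `N` is dual `M`-CS-Rickart: for every `f : M ⟶ N` the cokernel morphism factors as a
retraction followed by a superfluous epimorphism. -/
def IsDualCSRickart (M N : 𝒜) : Prop :=
  ∀ f : M ⟶ N, ∃ (P : 𝒜) (r : N ⟶ P) (t : P ⟶ cokernel f),
    IsSplitEpi r ∧ IsSuperfluousEpi t ∧ cokernel.π f = r ≫ t

/-- `N` is `M`-Rickart: the kernel morphism of every `f : M ⟶ N` is a section. -/
def IsRickart (M N : 𝒜) : Prop := ∀ f : M ⟶ N, IsSplitMono (kernel.ι f)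

/-- `N` is dual `M`-Rickart: the cokernel morphism of every `f : M ⟶ N` is a retraction. -/
def IsDualRickart (M N : 𝒜) : Prop := ∀ f : M ⟶ N, IsSplitEpi (cokernel.π f)

/-- `N` is `M`-𝒦-nonsingular. -/
def IsKNonsingular (M N : 𝒜) : Prop :=
  ∀ f : M ⟶ N, IsEssentialMono (kernel.ι f) → f = 0

/-- `M` is `N`-𝒯-nonsingular. -/
def IsTNonsingular (M N : 𝒜) : Prop :=
  ∀ f : M ⟶ N, IsSuperfluousEpi (cokernel.π f) → f = 0

/-- `M'` is a direct summand of `M`: `M ≅ M' ⊕ M''` for some `M''`. -/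
def IsDirectSummand (M' M : 𝒜) : Prop := ∃ M'' : 𝒜, Nonempty (M ≅ M' ⊞ M'')

/-- For subobjects `X ≤ D` of `M`: `X` is essential in `D`, i.e. every subobject of `D`
meeting `X` trivially is zero. -/
def EssentialIn {M : 𝒜} (X D : Subobject M) : Prop :=
  X ≤ D ∧ ∀ Y : Subobject M, Y ≤ D → X ⊓ Y = ⊥ → Y = ⊥

/-- `X` is essential in a direct summand of `M`. -/
def EssentialInDirectSummand {M : 𝒜} (X : Subobject M) : Prop :=
  ∃ D : Subobject M, IsSplitMono D.arrow ∧ EssentialIn X D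

/-- `M` has SIP-extending. -/
def SIPExtending (M : 𝒜) : Prop :=
  ∀ X₁ X₂ : Subobject M, EssentialInDirectSummand X₁ → EssentialInDirectSummand X₂ →
    EssentialInDirectSummand (X₁ ⊓ X₂)

/-- `S` is a superfluous subobject of `Q`. -/
def SuperfluousIn {Q : 𝒜} (S : Subobject Q) : Prop :=
  ∀ Y : Subobject Q, S ⊔ Y = ⊤ → Y = ⊤

/-- `L` lies above a direct summand of `M`: there is a direct summand subobject `K ≤ L`
such that the image of `L` in `M/K` is superfluous in `M/K`. -/
def LiesAboveDirectSummand {M : 𝒜} (L : Subobject M) : Prop :=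
  ∃ K : Subobject M, IsSplitMono K.arrow ∧ K ≤ L ∧
    SuperfluousIn (Subobject.mk (image.ι (L.arrow ≫ cokernel.π K.arrow)))

/-- `M` has SSP-lifting. -/
def SSPLifting (M : 𝒜) : Prop :=
  ∀ L₁ L₂ : Subobject M, LiesAboveDirectSummand L₁ → LiesAboveDirectSummand L₂ →
    LiesAboveDirectSummand (L₁ ⊔ L₂)

/-- `M` is extending: every subobject of `M` is essential in a direct summand of `M`. -/
def Extending (M : 𝒜) : Prop := ∀ X : Subobject M, EssentialInDirectSummand X

attribute [local instance] CategoryTheory.Abelian.hasFiniteBiproducts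

/-- A morphism `k` has superfluous image if `k ≫ y` is never an epi for nonzero `y`. -/
def HasSuperfluousImage {K P : 𝒜} (k : K ⟶ P) : Prop :=
  ∀ ⦃H : 𝒜⦄ (y : P ⟶ H), Epi (k ≫ y) → y = 0

theorem HasSuperfluousImage.comp {K P P' : 𝒜} {k : K ⟶ P} (hk : HasSuperfluousImage k)
    (q : P ⟶ P') : HasSuperfluousImage (k ≫ q) := by
  intro H y hy
  have h0 : q ≫ y = 0 := hk (q ≫ y) (by simpa using hy)
  have hz : (k ≫ q) ≫ y = 0 := by rw [Category.assoc, h0, comp_zero]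
  have hH : 𝟙 H = 0 := by rw [← cancel_epi ((k ≫ q) ≫ y), hz, zero_comp, zero_comp]
  rw [← Category.comp_id y, hH, comp_zero]

theorem HasSuperfluousImage.biprod_desc {K₁ K₂ P : 𝒜} {k₁ : K₁ ⟶ P} {k₂ : K₂ ⟶ P}
    (h₁ : HasSuperfluousImage k₁) (h₂ : HasSuperfluousImage k₂) :
    HasSuperfluousImage (biprod.desc k₁ k₂) := by
  intro H y hy
  have hy' : Epi y := epi_of_epi (biprod.desc k₁ k₂) y
  have hepi : Epi (k₂ ≫ y ≫ cokernel.π (k₁ ≫ y)) := by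
    refine Preadditive.epi_of_cancel_zero _ fun z hz => ?_
    rw [← cancel_epi (cokernel.π (k₁ ≫ y)), ← cancel_epi (biprod.desc k₁ k₂ ≫ y), comp_zero,
      comp_zero]
    apply biprod.hom_ext'
    · have := cokernel.condition (k₁ ≫ y)
      simp only [Category.assoc] at this
      simp [reassoc_of% this]
    · simpa using hz
  have h0 := h₂ _ hepi
  have hπ : cokernel.π (k₁ ≫ y) = 0 := by rw [← cancel_epi y, h0, comp_zero]
  exact h₁ y (Preadditive.epi_of_cokernel_zero hπ)

theorem IsSuperfluousEpi.hasSuperfluousImage_kernel_ι {P C : 𝒜} {t : P ⟶ C}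
    (ht : IsSuperfluousEpi t) : HasSuperfluousImage (kernel.ι t) := by
  intro H y hy
  have := ht.1
  have hy' : Epi y := epi_of_epi (kernel.ι t) y
  have hepi : Epi (kernel.ι y ≫ t) := by
    refine Preadditive.epi_of_cancel_zero _ fun z hz => ?_
    rw [Category.assoc] at hz
    have hw : y ≫ Abelian.epiDesc y (t ≫ z) hz = t ≫ z := Abelian.comp_epiDesc _ _ _
    have hw0 : Abelian.epiDesc y (t ≫ z) hz = 0 := by
      rw [← cancel_epi (kernel.ι t ≫ y), Category.assoc, hw]
      simp
    rw [← cancel_epi t, ← hw, hw0, comp_zero, comp_zero]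
  have := ht.2 _ hepi
  rw [← cancel_epi (kernel.ι y)]
  simp

theorem HasSuperfluousImage.isSuperfluousEpi {K P C : 𝒜} {k : K ⟶ P}
    (hk : HasSuperfluousImage k) (t : P ⟶ C) [Epi t]
    (hfac : ∀ ⦃Z : 𝒜⦄ (x : P ⟶ Z), k ≫ x = 0 → ∃ y, x = t ≫ y) : IsSuperfluousEpi t := by
  refine ⟨inferInstance, fun Q h hh => ?_⟩
  refine Preadditive.epi_of_cokernel_zero (hk _ ?_)
  refine Preadditive.epi_of_cancel_zero _ fun z hz => ?_
  obtain ⟨y, hy⟩ := hfac (cokernel.π h ≫ z) (by simpa using hz)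
  have hy0 : y = 0 := by
    rw [← cancel_epi (h ≫ t), Category.assoc, ← hy]
    simp
  rw [← cancel_epi (cokernel.π h), hy, hy0, comp_zero, comp_zero]

theorem IsDualCSRickart.of_epi {M M' N : 𝒜} (p : M ⟶ M') [Epi p]
    (h : IsDualCSRickart M N) : IsDualCSRickart M' N := by
  intro f
  obtain ⟨P, r, t, hr, ht, hc⟩ := h (p ≫ f)
  refine ⟨P, r, t ≫ (cokernelEpiComp p f).hom, hr, ⟨?_, fun Q h hh => ht.2 h ?_⟩, ?_⟩
  · have := ht.1
    infer_instance
  · have : h ≫ t = (h ≫ t ≫ (cokernelEpiComp p f).hom) ≫ (cokernelEpiComp p f).inv := by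
      rw [Category.assoc, Category.assoc, Iso.hom_inv_id, Category.comp_id]
    rw [this]
    infer_instance
  · rw [← reassoc_of% hc]
    simp [cokernelEpiComp]

theorem IsDualCSRickart.of_isZero {M N : 𝒜} (hM : IsZero M) : IsDualCSRickart M N := by
  intro f
  obtain rfl : f = 0 := hM.eq_of_src _ _
  refine ⟨N, 𝟙 N, cokernel.π _, inferInstance, ⟨inferInstance, fun Q h hh => ?_⟩, by simp⟩
  have : h = (h ≫ cokernel.π (0 : M ⟶ N)) ≫ inv (cokernel.π (0 : M ⟶ N)) := by simp
  rw [this]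
  infer_instance

theorem IsDualCSRickart.of_jointly_epi {M₁ M₂ B N : 𝒜} (i₁ : M₁ ⟶ B) (i₂ : M₂ ⟶ B)
    (hi : ∀ ⦃Z : 𝒜⦄ (x : B ⟶ Z), i₁ ≫ x = 0 → i₂ ≫ x = 0 → x = 0)
    (h₁ : IsDualCSRickart M₁ N) (h₂ : IsDualCSRickart M₂ N) : IsDualCSRickart B N := by
  intro f
  obtain ⟨P₁, r₁, t₁, ⟨⟨⟨s₁, hs₁⟩⟩⟩, ht₁, hc₁⟩ := h₁ (i₁ ≫ f)
  obtain ⟨P₂, r₂, t₂, ⟨⟨⟨s₂, hs₂⟩⟩⟩, ht₂, hc₂⟩ := h₂ (i₂ ≫ f ≫ r₁ ≫ s₁)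
  have := ht₁.1
  have := ht₂.1
  have : IsSplitEpi r₁ := ⟨⟨⟨s₁, hs₁⟩⟩⟩
  have hker : kernel.ι r₂ ≫ r₁ ≫ s₁ = kernel.ι r₂ := by
    let e := cokernel.desc (i₂ ≫ f ≫ r₁ ≫ s₁) (𝟙 N - r₁ ≫ s₁)
      (by simp [Preadditive.comp_sub, reassoc_of% hs₁])
    have he : r₂ ≫ t₂ ≫ e = 𝟙 N - r₁ ≫ s₁ := by
      rw [← reassoc_of% hc₂]
      exact cokernel.π_desc _ _ _
    have h0 : kernel.ι r₂ ≫ (𝟙 N - r₁ ≫ s₁) = 0 := by rw [← he]; simp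
    rw [Preadditive.comp_sub, Category.comp_id, sub_eq_zero] at h0
    exact h0.symm
  let u := kernel.ι r₂ ≫ r₁
  have hu : kernel.ι r₂ ≫ r₁ ≫ cokernel.π u = 0 := by
    rw [← Category.assoc]
    exact cokernel.condition u
  have hb : r₂ ≫ s₂ ≫ r₁ ≫ cokernel.π u = r₁ ≫ cokernel.π u := by
    let w := kernel.lift r₂ (𝟙 N - r₂ ≫ s₂) (by simp [Preadditive.sub_comp, hs₂])
    have hw : w ≫ kernel.ι r₂ = 𝟙 N - r₂ ≫ s₂ := kernel.lift_ι _ _ _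
    have h0 : (𝟙 N - r₂ ≫ s₂) ≫ r₁ ≫ cokernel.π u = 0 := by
      rw [← hw, Category.assoc, hu, comp_zero]
    rw [Preadditive.sub_comp, Category.id_comp, sub_eq_zero] at h0
    simpa using h0.symm
  let σ : cokernel u ⟶ P₁ := cokernel.desc u (s₁ ≫ r₂ ≫ s₂ ≫ r₁)
    (by simp [u, reassoc_of% hker])
  have hσ : σ ≫ cokernel.π u = 𝟙 _ := by
    rw [← cancel_epi (cokernel.π u)]
    simp [σ, hb, reassoc_of% hs₁]
  let d : cokernel (i₁ ≫ f) ⟶ cokernel f := cokernel.desc _ (cokernel.π f) (by simp)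
  have hd : r₁ ≫ t₁ ≫ d = cokernel.π f := by
    rw [← reassoc_of% hc₁]
    exact cokernel.π_desc _ _ _
  have hrs : r₁ ≫ s₁ ≫ cokernel.π f = cokernel.π f := by
    rw [← hd, reassoc_of% hs₁]
  have hkc : kernel.ι r₂ ≫ cokernel.π f = 0 := by
    let d₂ := cokernel.desc (i₂ ≫ f ≫ r₁ ≫ s₁) (cokernel.π f) (by simp [hrs])
    have hd₂ : r₂ ≫ t₂ ≫ d₂ = cokernel.π f := by
      rw [← reassoc_of% hc₂]
      exact cokernel.π_desc _ _ _
    rw [← hd₂]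
    simp
  let t : cokernel u ⟶ cokernel f := cokernel.desc u (t₁ ≫ d) (by simp [u, hd, hkc])
  have ht : cokernel.π f = (r₁ ≫ cokernel.π u) ≫ t := by simp [t, hd]
  have : Epi ((r₁ ≫ cokernel.π u) ≫ t) := by rw [← ht]; infer_instance
  have : Epi t := epi_of_epi (r₁ ≫ cokernel.π u) t
  refine ⟨cokernel u, r₁ ≫ cokernel.π u, t, ⟨⟨⟨σ ≫ s₁, by simp [reassoc_of% hs₁, hσ]⟩⟩⟩, ?_, ht⟩
  refine HasSuperfluousImage.isSuperfluousEpi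
    ((ht₁.hasSuperfluousImage_kernel_ι.comp (cokernel.π u)).biprod_desc
      (ht₂.hasSuperfluousImage_kernel_ι.comp (s₂ ≫ r₁ ≫ cokernel.π u))) t fun Z x hx => ?_
  have hx₁ : kernel.ι t₁ ≫ cokernel.π u ≫ x = 0 := by
    simpa using biprod.inl ≫= hx
  have hx₂ : kernel.ι t₂ ≫ s₂ ≫ r₁ ≫ cokernel.π u ≫ x = 0 := by
    simpa using biprod.inr ≫= hx
  have hf₁ : i₁ ≫ f ≫ r₁ ≫ cokernel.π u ≫ x = 0 := by
    have h0 := cokernel.condition (i₁ ≫ f)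
    rw [hc₁] at h0
    simp only [Category.assoc] at h0
    rw [← Abelian.comp_epiDesc t₁ _ hx₁, reassoc_of% h0, zero_comp]
  have hf₂ : i₂ ≫ f ≫ r₁ ≫ cokernel.π u ≫ x = 0 := by
    have h0 := cokernel.condition (i₂ ≫ f ≫ r₁ ≫ s₁)
    rw [hc₂] at h0
    simp only [Category.assoc] at h0
    have h1 : r₁ ≫ s₁ ≫ r₁ ≫ cokernel.π u ≫ x = r₁ ≫ cokernel.π u ≫ x := by
      rw [reassoc_of% hs₁]
    rw [← h1, ← reassoc_of% hb, ← Abelian.comp_epiDesc t₂ _ hx₂, reassoc_of% h0, zero_comp]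
  refine ⟨cokernel.desc f (r₁ ≫ cokernel.π u ≫ x) (hi _ hf₁ hf₂), ?_⟩
  rw [← cancel_epi (r₁ ≫ cokernel.π u), ← Category.assoc _ t, ← ht]
  simp

/-- `N` is dual `⨁ᵢ₌₁ⁿ Mᵢ`-CS-Rickart iff `N` is dual `Mᵢ`-CS-Rickart
for every `i`. -/
theorem stmt16 (n : ℕ) (Mi : Fin n → 𝒜) (N : 𝒜) :
    IsDualCSRickart (⨁ Mi) N ↔ ∀ i, IsDualCSRickart (Mi i) N := by
  refine ⟨fun h i => h.of_epi (biproduct.π Mi i), fun h => ?_⟩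
  induction n with
  | zero =>
    refine .of_isZero ((IsZero.iff_id_eq_zero _).2 (biproduct.hom_ext _ _ fun j => j.elim0))
  | succ n ih =>
    refine .of_jointly_epi (biproduct.ι Mi 0) (biproduct.desc fun j : Fin n => biproduct.ι Mi j.succ)
      (fun Z x h₀ h₁ => biproduct.hom_ext' _ _ fun j => ?_) (h 0)
      (ih (fun j => Mi j.succ) fun j => h j.succ)
    refine Fin.cases ?_ (fun j => ?_) j
    · simpa using h₀
    · simpa using biproduct.ι (fun j => Mi j.succ) j ≫= h₁
end

section
/- Let M be an object of an abelian category 𝒜 having SSIP-extending, and let (Nᵢ)_{i∈I} be a family of objects of 𝒜 admitting a product ∏_{i∈I} Nᵢ in 𝒜. Then ∏_{i∈I} Nᵢ is M-CS-Rickart if and only if Nᵢ is M-CS-Rickart for every i ∈ I. -/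
open CategoryTheory CategoryTheory.Limits

universe v u

variable {𝒜 : Type u} [Category.{v} 𝒜] [Abelian 𝒜]

universe w

/-- `M` has SSIP-extending: for any family of subobjects of `M`, each of which is essential
in a direct summand of `M`, their meet (greatest lower bound) is essential in a direct
summand of `M`. -/
def SSIPExtending (M : 𝒜) : Prop :=
  ∀ {ι : Type w} (X : ι → Subobject M) (Z : Subobject M),
    (∀ i, EssentialInDirectSummand (X i)) → IsGLB (Set.range X) Z →
      EssentialInDirectSummand Z

theorem subobject_mk_factors_iff_exists {C : Type*} [Category* C] {K L M : C} (k : K ⟶ M) [Mono k]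
    (g : L ⟶ M) :
    (Subobject.mk k).Factors g ↔ ∃ a : L ⟶ K, a ≫ k = g :=
  Iff.rfl

/-- The subobject of a monomorphism `k` is essential in a direct summand if and only if `k`
factors as an essential monomorphism followed by a section. -/
theorem essentialInDirectSummand_mk_iff {K M : 𝒜} (k : K ⟶ M) [Mono k] :
    EssentialInDirectSummand (Subobject.mk k) ↔
      ∃ (L : 𝒜) (e : K ⟶ L) (s : L ⟶ M), IsEssentialMono e ∧ IsSplitMono s ∧ k = e ≫ s := by
  constructor
  · rintro ⟨D, hD, hle, hess⟩
    have hk : D.Factors k := Subobject.factors_of_le k hle (Subobject.mk_factors_self k)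
    have hfac : D.factorThru k hk ≫ D.arrow = k := Subobject.factorThru_arrow _ _ _
    refine ⟨(D : 𝒜), D.factorThru k hk, D.arrow, ⟨?_, fun P h hmono => ?_⟩, hD, hfac.symm⟩
    · have : Mono (D.factorThru k hk ≫ D.arrow) := by rw [hfac]; infer_instance
      exact mono_of_mono _ D.arrow
    · have hY : Subobject.mk (kernel.ι h ≫ D.arrow) = ⊥ := by
        refine hess _ (Subobject.mk_le_of_comm (kernel.ι h) rfl) ?_
        rw [← Subobject.mk_arrow (Subobject.mk k ⊓ _), Subobject.mk_eq_bot_iff_zero]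
        obtain ⟨hX, hY⟩ := (Subobject.inf_factors _).1
          (Subobject.factors_self (Subobject.mk k ⊓ Subobject.mk (kernel.ι h ≫ D.arrow)))
        obtain ⟨a, ha⟩ := (subobject_mk_factors_iff_exists _ _).1 hX
        obtain ⟨b, hb⟩ := (subobject_mk_factors_iff_exists _ _).1 hY
        have hab : a ≫ D.factorThru k hk = b ≫ kernel.ι h := by
          rw [← cancel_mono D.arrow, Category.assoc, Category.assoc, hfac, ha, hb]
        have ha0 : a = 0 := by
          rw [← cancel_mono (D.factorThru k hk ≫ h), ← Category.assoc, hab]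
          simp
        rw [← ha, ha0, zero_comp]
      rw [Subobject.mk_eq_bot_iff_zero] at hY
      exact Preadditive.mono_of_kernel_zero (zero_of_comp_mono D.arrow hY)
  · rintro ⟨L, e, s, ⟨_, he⟩, hs, rfl⟩
    refine ⟨Subobject.mk s, ?_, Subobject.mk_le_mk_of_comm e rfl, fun Y hY hinf => ?_⟩
    · rw [← Subobject.underlyingIso_hom_comp_eq_mk]
      infer_instance
    · obtain ⟨y, hy⟩ := (subobject_mk_factors_iff_exists s _).1
        (Subobject.factors_of_le _ hY (Subobject.factors_self Y))
      have hymono : Mono y := by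
        have : Mono (y ≫ s) := by rw [hy]; infer_instance
        exact mono_of_mono y s
      have : Mono (cokernel.π y) := by
        refine he _ (Preadditive.mono_of_cancel_zero _ fun g hg => ?_)
        rw [← Category.assoc] at hg
        have hl : Abelian.monoLift y (g ≫ e) hg ≫ y = g ≫ e := Abelian.monoLift_comp _ _ _
        have hfac : (Subobject.mk (e ≫ s) ⊓ Y).Factors (g ≫ e ≫ s) := by
          refine (Subobject.inf_factors _).2 ⟨⟨g, rfl⟩, ?_⟩
          refine (Subobject.factors_iff _ _).2 ⟨Abelian.monoLift y (g ≫ e) hg, ?_⟩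
          change _ ≫ Y.arrow = _
          rw [← hy, ← Category.assoc, hl, Category.assoc]
        rw [hinf, Subobject.bot_factors_iff_zero] at hfac
        exact zero_of_comp_mono (e ≫ s) hfac
      have hy0 : y = 0 := zero_of_comp_mono (cokernel.π y) (cokernel.condition y)
      rw [← Subobject.mk_arrow Y, Subobject.mk_eq_bot_iff_zero, ← hy, hy0, zero_comp]

theorem isCSRickart_iff_kernelSubobject (M N : 𝒜) :
    IsCSRickart M N ↔ ∀ f : M ⟶ N, EssentialInDirectSummand (kernelSubobject f) :=
  forall_congr' fun f => (essentialInDirectSummand_mk_iff (kernel.ι f)).symm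

/-- The kernel of a morphism into a product is the meet of the kernels of its components. -/
theorem isGLB_kernelSubobject_comp_pi_π {M : 𝒜} {I : Type*} (N : I → 𝒜) [HasProduct N]
    (f : M ⟶ ∏ᶜ N) :
    IsGLB (Set.range fun i => kernelSubobject (f ≫ Pi.π N i)) (kernelSubobject f) := by
  constructor
  · rintro _ ⟨i, rfl⟩
    exact le_kernelSubobject _ _ (by rw [← Category.assoc, kernelSubobject_arrow_comp, zero_comp])
  · intro Y hY
    refine le_kernelSubobject _ _ (Pi.hom_ext _ _ fun i => ?_)
    have := (kernelSubobject_factors_iff _ _).1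
      (Subobject.factors_of_le _ (hY ⟨i, rfl⟩) (Subobject.factors_self Y))
    simpa using this

theorem IsCSRickart.of_mono {M N N' : 𝒜} (h : IsCSRickart M N') (g : N ⟶ N') [Mono g] :
    IsCSRickart M N := by
  rw [isCSRickart_iff_kernelSubobject] at h ⊢
  intro f
  rw [← kernelSubobject_comp_mono f g]
  exact h (f ≫ g)

/-- If `M` has SSIP-extending and `(Nᵢ)_{i∈I}` is a family of objects
admitting a product, then `∏ᵢ Nᵢ` is `M`-CS-Rickart iff each `Nᵢ` is `M`-CS-Rickart. -/
theorem stmt17 (M : 𝒜) (hM : SSIPExtending.{v, u, w} M)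
    {I : Type w} (N : I → 𝒜) [HasProduct N] :
    IsCSRickart M (∏ᶜ N) ↔ ∀ i, IsCSRickart M (N i) := by
  classical
  refine ⟨fun h i => ?_, fun h => ?_⟩
  · let g : N i ⟶ ∏ᶜ N := Pi.lift (Pi.single i (𝟙 (N i)))
    have hg : g ≫ Pi.π N i = 𝟙 _ := by simp [g]
    have : Mono g := mono_of_mono_fac hg
    exact h.of_mono g
  · rw [isCSRickart_iff_kernelSubobject]
    intro f
    exact hM _ _ (fun i => (isCSRickart_iff_kernelSubobject M (N i)).1 (h i) _)
      (isGLB_kernelSubobject_comp_pi_π N f)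
end

section
/- Let 𝒜 be an abelian category with enough injectives, and let 𝒞 be a class of objects of 𝒜 which is closed under binary direct sums and contains all injective objects of 𝒜. Then every object of 𝒞 is extending if and only if every object of 𝒞 is self-CS-Rickart. -/
open CategoryTheory CategoryTheory.Limits

universe v u

variable {𝒜 : Type u} [Category.{v} 𝒜] [Abelian 𝒜]

/-- A nonzero subobject of the target of an essential monomorphism meets its source. -/
lemma IsEssentialMono.eq_zero {K L Y : 𝒜} {e : K ⟶ L} (he : IsEssentialMono e) (y : Y ⟶ L)
    [Mono y] (h : ∀ ⦃Z : 𝒜⦄ (z : Z ⟶ K) (w : Z ⟶ Y), z ≫ e = w ≫ y → w = 0) : y = 0 := by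
  have : Mono e := he.1
  have : Mono (cokernel.π y) := he.2 _ <| Preadditive.mono_of_cancel_zero _ fun z hz => by
    have hz' : (z ≫ e) ≫ cokernel.π y = 0 := by simpa using hz
    have hw := Abelian.monoLift_comp y (z ≫ e) hz'
    rw [h z _ hw.symm, zero_comp] at hw
    exact zero_of_comp_mono e hw.symm
  exact eq_zero_of_mono_cokernel y

lemma inf_eq_bot_iff_forall_factors {M : 𝒜} {X Y : Subobject M} :
    X ⊓ Y = ⊥ ↔ ∀ ⦃Z : 𝒜⦄ (g : Z ⟶ M), X.Factors g → Y.Factors g → g = 0 := by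
  refine ⟨fun h Z g hX hY => ?_, fun h => ?_⟩
  · rw [← Subobject.bot_factors_iff_zero, ← h, Subobject.inf_factors]
    exact ⟨hX, hY⟩
  · have h' := (Subobject.inf_factors _).1 (Subobject.factors_self (X ⊓ Y))
    rw [eq_bot_iff]
    exact Subobject.le_of_factors ((Subobject.bot_factors_iff_zero _).2 (h _ h'.1 h'.2))

lemma EssentialIn.isEssentialMono_ofLE {M : 𝒜} {X D : Subobject M} (h : EssentialIn X D) :
    IsEssentialMono (Subobject.ofLE X D h.1) := by
  refine ⟨inferInstance, fun P g hg => Preadditive.mono_of_kernel_zero ?_⟩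
  have hbot : Subobject.mk (kernel.ι g ≫ D.arrow) = ⊥ := by
    refine h.2 _ (Subobject.mk_le_of_comm (kernel.ι g) rfl) ?_
    rw [inf_eq_bot_iff_forall_factors]
    rintro Z _ hX ⟨w, rfl⟩
    change Z ⟶ kernel g at w
    change X.Factors (w ≫ kernel.ι g ≫ D.arrow) at hX
    have hw : X.factorThru _ hX ≫ Subobject.ofLE X D h.1 = w ≫ kernel.ι g := by
      simp [← cancel_mono D.arrow]
    have hz : X.factorThru _ hX = 0 := by
      refine zero_of_comp_mono (Subobject.ofLE X D h.1 ≫ g) ?_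
      rw [reassoc_of% hw, kernel.condition, comp_zero]
    change w ≫ kernel.ι g ≫ D.arrow = 0
    rw [← reassoc_of% hw, hz, zero_comp]
  exact zero_of_comp_mono D.arrow (Subobject.mk_eq_bot_iff_zero.1 hbot)

lemma Extending.isCSRickart {M N : 𝒜} (h : Extending M) : IsCSRickart M N := by
  intro f
  obtain ⟨D, hD, hX⟩ := h (kernelSubobject f)
  have he := hX.isEssentialMono_ofLE
  refine ⟨D, (kernelSubobjectIso f).inv ≫ Subobject.ofLE _ D hX.1, D.arrow, ?_, hD, by simp⟩
  have : Mono (Subobject.ofLE _ D hX.1) := he.1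
  refine ⟨inferInstance, fun P g hg => he.2 g ?_⟩
  rw [Category.assoc] at hg
  simpa using mono_comp (kernelSubobjectIso f).hom
    ((kernelSubobjectIso f).inv ≫ Subobject.ofLE _ D hX.1 ≫ g)

/-- If the kernel of `(m, e) ↦ (0, p m)` on `M ⊞ E` is essential in a direct summand, then so is
the kernel of `p : M ⟶ E`. -/
lemma essentialInDirectSummand_of_isCSRickart_biprod {M E : 𝒜} (h : IsCSRickart (M ⊞ E) (M ⊞ E))
    (X : Subobject M) (p : M ⟶ E) (hp : X.arrow ≫ p = 0)
    (hX : ∀ ⦃Z : 𝒜⦄ (g : Z ⟶ M), g ≫ p = 0 → X.Factors g) : EssentialInDirectSummand X := by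
  let f : M ⊞ E ⟶ M ⊞ E := biprod.fst ≫ p ≫ biprod.inr
  obtain ⟨L, e, s, he, ⟨⟨r, hr⟩⟩, hes⟩ := h f
  have hs : Mono s := mono_of_mono_fac hr
  let t : E ⟶ L := kernel.lift f biprod.inr (by simp [f]) ≫ e
  have ht : t ≫ s = biprod.inr := by simp [t, ← hes]
  let k := kernel.ι (s ≫ biprod.snd)
  have hk : k ≫ s ≫ biprod.snd = 0 := kernel.condition _
  let a : kernel (s ≫ biprod.snd) ⟶ M := k ≫ s ≫ biprod.fst
  have ha : a ≫ biprod.inl = k ≫ s := by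
    ext <;> simp [a, hk]
  let q : L ⟶ L := 𝟙 L - s ≫ biprod.snd ≫ t
  have hq : q ≫ s ≫ biprod.snd = 0 := by
    simp [q, Preadditive.sub_comp, reassoc_of% ht]
  let ρ : M ⟶ kernel (s ≫ biprod.snd) :=
    kernel.lift _ (biprod.inl ≫ r ≫ q) (by simp [hq])
  have haρ : a ≫ ρ = 𝟙 _ := by
    rw [← cancel_mono (kernel.ι (s ≫ biprod.snd))]
    simp only [ρ, Category.assoc, kernel.lift_ι, Category.id_comp]
    rw [reassoc_of% ha, reassoc_of% hr]
    simp [q, Preadditive.comp_sub, reassoc_of% hk, k]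
  have hma : IsSplitMono a := ⟨⟨ρ, haρ⟩⟩
  let u : (X : 𝒜) ⟶ L := kernel.lift f (X.arrow ≫ biprod.inl) (by simp [f, reassoc_of% hp]) ≫ e
  have hu : u ≫ s = X.arrow ≫ biprod.inl := by simp [u, ← hes]
  refine ⟨Subobject.mk a, ?_, ?_, fun Y hY hXY => ?_⟩
  · exact ⟨⟨ρ ≫ (Subobject.underlyingIso a).inv, by
      rw [← cancel_epi (Subobject.underlyingIso a).inv]; simp [reassoc_of% haρ]⟩⟩
  · refine Subobject.le_mk_of_comm (kernel.lift _ u ?_) ?_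
    · simp [reassoc_of% hu]
    · simp [a, k, reassoc_of% hu]
  · rw [inf_eq_bot_iff_forall_factors] at hXY
    let y := Subobject.ofLEMk Y a hY
    have hya : y ≫ a = Y.arrow := Subobject.ofLEMk_comp hY
    have hy : y ≫ k = 0 := he.eq_zero (y ≫ k) fun Z z w hzw => by
      have hw : z ≫ kernel.ι f ≫ biprod.fst = w ≫ Y.arrow := by
        rw [hes, Category.assoc, reassoc_of% hzw, ← hya]
      have hz : (w ≫ Y.arrow) ≫ p = 0 := by
        rw [← hw]
        have := z ≫= (kernel.condition f =≫ biprod.snd)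
        simpa only [f, Category.assoc, biprod.inr_snd, Category.comp_id, zero_comp, comp_zero]
          using this
      exact zero_of_comp_mono Y.arrow (hXY _ (hX _ hz) (Subobject.factors_comp_arrow w))
    have hY0 : Y.arrow = 0 := by rw [← hya]; simp only [a]; rw [reassoc_of% hy, zero_comp]
    rw [eq_bot_iff]
    exact Subobject.le_of_factors ((Subobject.bot_factors_iff_zero _).2 hY0)

/-- Let `𝒜` have enough injectives and let `𝒞` be a class of objects closed
under binary direct sums and containing all injective objects. Then every object of `𝒞` is
extending iff every object of `𝒞` is self-CS-Rickart. -/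
theorem stmt19 [EnoughInjectives 𝒜] (𝒞 : Set 𝒜)
    (hsum : ∀ X Y : 𝒜, X ∈ 𝒞 → Y ∈ 𝒞 → (X ⊞ Y) ∈ 𝒞)
    (hinj : ∀ X : 𝒜, Injective X → X ∈ 𝒞) :
    (∀ M ∈ 𝒞, Extending M) ↔ (∀ M ∈ 𝒞, IsCSRickart M M) := by
  refine ⟨fun h M hM => (h M hM).isCSRickart, fun h M hM X => ?_⟩
  let E := Injective.under (cokernel X.arrow)
  refine essentialInDirectSummand_of_isCSRickart_biprod
    (h _ (hsum M E hM (hinj E inferInstance))) X (cokernel.π X.arrow ≫ Injective.ι _)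
    (by simp) fun Z g hg => ?_
  have hg' : g ≫ cokernel.π X.arrow = 0 :=
    zero_of_comp_mono (Injective.ι (cokernel X.arrow)) (by simpa using hg)
  rw [← Abelian.monoLift_comp X.arrow g hg']
  exact Subobject.factors_comp_arrow _
end
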